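/- arXiv:1906.05931 — 3 statements merged into one kernel-verified Lean document; each statement's English description precedes it below -/
import Mathlib

section
/- Let a, b, p, q be real numbers. For all natural numbers m and n with m ≥ n, w_{m+n} - q^n·w_{m-n} = h_m·u_n. -/
/-- Second-order linear recurrence sequence with coefficients `p, q`
and initial values `x0, x1`: `x (n+2) = p * x (n+1) - q * x n`. -/
def rec2 (p q x0 x1 : ℝ) : ℕ → ℝ
  | 0 => x0
  | 1 => x1
  | n + 2 => p * rec2 p q x0 x1 (n + 1) - q * rec2 p q x0 x1 n

/-- The Horadam sequence `w_0 = a`, `w_1 = b`. -/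
noncomputable def horadam (a b p q : ℝ) : ℕ → ℝ := rec2 p q a b

/-- The Horadam-Lucas sequence `h_0 = 2b - ap`, `h_1 = bp - 2aq`. -/
noncomputable def horadamLucas (a b p q : ℝ) : ℕ → ℝ :=
  rec2 p q (2 * b - a * p) (b * p - 2 * a * q)

/-- The sequence `u` with `u_0 = 0`, `u_1 = 1`. -/
noncomputable def useq (p q : ℝ) : ℕ → ℝ := rec2 p q 0 1

/-- The sequence `v` with `v_0 = 2`, `v_1 = p`. -/
noncomputable def vseq (p q : ℝ) : ℕ → ℝ := rec2 p q 2 p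

theorem rec2_add_two (p q x y : ℝ) (n : ℕ) :
    rec2 p q x y (n + 2) = p * rec2 p q x y (n + 1) - q * rec2 p q x y n := by
  rw [rec2]

theorem rec2_add (p q x y : ℝ) (m n : ℕ) :
    rec2 p q x y (m + n) = rec2 p q x y m * useq p q (n + 1) +
      (rec2 p q x y (m + 1) - p * rec2 p q x y m) * useq p q n := by
  unfold useq
  induction n using Nat.twoStepInduction with
  | zero => simp [rec2]
  | one => simp [rec2]; ring
  | more n ih₀ ih₁ =>
    rw [← add_assoc, rec2_add_two, add_assoc m n 1, ih₀, ih₁, rec2_add_two p q 0 1 (n + 1),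
      rec2_add_two p q 0 1 n]
    ring

theorem useq_cassini (p q : ℝ) (n : ℕ) :
    useq p q (n + 1) ^ 2 - p * useq p q n * useq p q (n + 1) + q * useq p q n ^ 2 = q ^ n := by
  unfold useq
  induction n with
  | zero => simp [rec2]
  | succ n ih =>
    rw [rec2_add_two, pow_succ q, ← ih]
    ring

theorem horadamLucas_eq (a b p q : ℝ) (n : ℕ) :
    horadamLucas a b p q n = 2 * horadam a b p q (n + 1) - p * horadam a b p q n := by
  unfold horadamLucas horadam
  induction n using Nat.twoStepInduction with
  | zero => simp [rec2]; ring
  | one => simp [rec2]; ring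
  | more n ih₀ ih₁ =>
    rw [rec2_add_two, ih₀, ih₁, rec2_add_two p q a b (n + 1), rec2_add_two p q a b n]
    ring

theorem horadam_add_sub (a b p q : ℝ) (m n : ℕ) (hmn : n ≤ m) :
    horadam a b p q (m + n) - q ^ n * horadam a b p q (m - n) =
      horadamLucas a b p q m * useq p q n := by
  obtain ⟨k, rfl⟩ := Nat.exists_eq_add_of_le' hmn
  rw [Nat.add_sub_cancel, horadamLucas_eq, ← useq_cassini]
  unfold horadam
  have hk := rec2_add p q a b k n
  have hk' := rec2_add p q a b k (n + 1)
  have hu : useq p q (n + 2) = p * useq p q (n + 1) - q * useq p q n := rec2_add_two p q 0 1 n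
  rw [← add_assoc, hu] at hk'
  rw [rec2_add p q a b (k + n) n, hk', hk]
  ring
end

section
/- Let a, b, p, q be real numbers. For every natural number n, h_{n+1}^2 - q·h_n^2 = (p^2 - 4q)·[(b^2 - a^2·q)·u_{2n+1} - a·q·(2b - ap)·u_{2n}]. -/
theorem rec2_succ_succ (p q x0 x1 : ℝ) (n : ℕ) :
    rec2 p q x0 x1 (n + 2) = p * rec2 p q x0 x1 (n + 1) - q * rec2 p q x0 x1 n := by
  rw [rec2]

theorem rec2_eq_useq (p q x0 x1 : ℝ) (n : ℕ) :
    rec2 p q x0 x1 n = x0 * useq p q (n + 1) + (x1 - p * x0) * useq p q n ∧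
      rec2 p q x0 x1 (n + 1) = x1 * useq p q (n + 1) - q * x0 * useq p q n := by
  unfold useq
  induction n with
  | zero => simp [rec2]
  | succ k ih =>
    obtain ⟨h0, h1⟩ := ih
    simp only [rec2_succ_succ, h0, h1]
    constructor <;> ring

theorem useq_double (p q : ℝ) (n : ℕ) :
    useq p q (2 * n) = useq p q n * (2 * useq p q (n + 1) - p * useq p q n) ∧
      useq p q (2 * n + 1) = useq p q (n + 1) ^ 2 - q * useq p q n ^ 2 := by
  unfold useq
  induction n with
  | zero => simp [rec2]
  | succ k ih =>
    obtain ⟨h0, h1⟩ := ih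
    rw [show 2 * (k + 1) = 2 * k + 2 by ring, show 2 * k + 2 + 1 = (2 * k + 1) + 2 by ring]
    simp only [rec2_succ_succ, h0, h1]
    constructor <;> ring

theorem horadamLucas_sq_sub_q_sq (a b p q : ℝ) (n : ℕ) :
    horadamLucas a b p q (n + 1) ^ 2 - q * horadamLucas a b p q n ^ 2 =
      (p ^ 2 - 4 * q) *
        ((b ^ 2 - a ^ 2 * q) * useq p q (2 * n + 1) -
          a * q * (2 * b - a * p) * useq p q (2 * n)) := by
  obtain ⟨h0, h1⟩ := rec2_eq_useq p q (2 * b - a * p) (b * p - 2 * a * q) n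
  obtain ⟨hu0, hu1⟩ := useq_double p q n
  unfold horadamLucas
  rw [h0, h1, hu0, hu1]
  ring
end

section
/- Let a, b, p, q be real numbers and set E = b^2 - abp + a^2·q. For every natural number n ≥ 1, Cassini's identity holds: h_{n+1}·h_{n-1} - h_n^2 = E·(p^2 - 4q)·q^{n-1}. -/
/-- Cassini's identity for a general second-order linear recurrence. -/
theorem rec2_cassini (p q x0 x1 : ℝ) (n : ℕ) :
    rec2 p q x0 x1 (n + 2) * rec2 p q x0 x1 n - rec2 p q x0 x1 (n + 1) ^ 2 =
      (p * x0 * x1 - q * x0 ^ 2 - x1 ^ 2) * q ^ n := by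
  induction n with
  | zero =>
    simp only [rec2]
    ring
  | succ n ih =>
    rw [pow_succ q, ← mul_assoc, ← ih]
    simp only [rec2]
    ring

theorem cassini_horadamLucas (a b p q : ℝ) (E : ℝ) (hE : E = b ^ 2 - a * b * p + a ^ 2 * q)
    (n : ℕ) (hn : 1 ≤ n) :
    horadamLucas a b p q (n + 1) * horadamLucas a b p q (n - 1) -
        horadamLucas a b p q n ^ 2 =
      E * (p ^ 2 - 4 * q) * q ^ (n - 1) := by
  obtain ⟨m, rfl⟩ := Nat.exists_eq_add_of_le' hn
  have h := rec2_cassini p q (2 * b - a * p) (b * p - 2 * a * q) m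
  simp only [horadamLucas, Nat.add_sub_cancel]
  rw [h, hE]
  ring
end
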